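/- Suppose d < δ. (1) If δ − d is even, then every generator of in(I,g) belonging to z^{2k}·B_{d+i*−k} for some 1 ≤ k ≤ i* or to z^{δ−d+2j}·B_{d−j} for some 1 ≤ j ≤ d satisfies property P with respect to in(I,g). (2) If δ − d is odd, then every generator of in(I,g) belonging to B_{d+i*+1}, to z^{2k−1}·B_{d+i*+1−k} for some 1 ≤ k ≤ i*+1, or to z^{δ−d+2j}·B_{d−j} for some 1 ≤ j ≤ d satisfies property P with respect to in(I,g). -/

import Mathlib

open MvPolynomial

/-- The total degree of an exponent vector. -/
def expDeg {n : ℕ} (μ : Fin n →₀ ℕ) : ℕ := μ.sum fun _ e => e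

/-- Strict degree reverse lexicographic order on exponent vectors, for variables
`x_1 > ⋯ > x_n` (indexed by `Fin n` in this order). -/
def DrlLT {n : ℕ} (a b : Fin n →₀ ℕ) : Prop :=
  expDeg a < expDeg b ∨
    (expDeg a = expDeg b ∧ ∃ i : Fin n, b i < a i ∧ ∀ j : Fin n, i < j → a j = b j)

/-- `μ` is the leading (degrevlex-largest) exponent of `p`. -/
def IsLeadExp {n : ℕ} {K : Type*} [CommSemiring K] (p : MvPolynomial (Fin n) K)
    (μ : Fin n →₀ ℕ) : Prop :=
  μ ∈ p.support ∧ ∀ ν ∈ p.support, ν ≠ μ → DrlLT ν μ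

/-- The initial ideal of `I` with respect to the degree reverse lexicographic order. -/
noncomputable def initialIdeal {n : ℕ} {K : Type*} [CommRing K]
    (I : Ideal (MvPolynomial (Fin n) K)) : Ideal (MvPolynomial (Fin n) K) :=
  Ideal.span { m | ∃ p ∈ I, p ≠ 0 ∧ ∃ μ, IsLeadExp p μ ∧ m = monomial μ (1 : K) }

/-- The standard monomials of degree `i` of `I` : exponents of the monomials of degree `i`
not lying in the initial ideal of `I`. -/
def stdMon {n : ℕ} {K : Type*} [CommRing K] (I : Ideal (MvPolynomial (Fin n) K)) (i : ℕ) :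
    Set (Fin n →₀ ℕ) :=
  { μ | expDeg μ = i ∧ monomial μ (1 : K) ∉ initialIdeal I }

/-- `μ` is a minimal monomial generator of the monomial ideal `M`. -/
def IsMinGen {n : ℕ} {K : Type*} [CommRing K] (M : Ideal (MvPolynomial (Fin n) K))
    (μ : Fin n →₀ ℕ) : Prop :=
  monomial μ (1 : K) ∈ M ∧ ∀ ν : Fin n →₀ ℕ, ν ≤ μ → ν ≠ μ → monomial ν (1 : K) ∉ M

/-- `μ` satisfies property `P` with respect to the monomial ideal `M`: if `m` is the largest
index of a variable dividing `x^μ`, then every monomial of the same degree in the variables of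
index `< m` also lies in `M`. -/
def SatisfiesP {n : ℕ} {K : Type*} [CommRing K] (M : Ideal (MvPolynomial (Fin n) K))
    (μ : Fin n →₀ ℕ) : Prop :=
  ∀ m : Fin n, μ m ≠ 0 → (∀ j : Fin n, m < j → μ j = 0) →
    ∀ ν : Fin n →₀ ℕ, expDeg ν = expDeg μ → (∀ j : Fin n, m ≤ j → ν j = 0) →
      monomial ν (1 : K) ∈ M

/-- Conjecture E (Pardue) holds for the ideal `I`: every minimal generator of the initial
ideal of `I` satisfies property `P`. -/
def ConjE {n : ℕ} {K : Type*} [CommRing K] (I : Ideal (MvPolynomial (Fin n) K)) : Prop :=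
  ∀ μ, IsMinGen (initialIdeal I) μ → SatisfiesP (initialIdeal I) μ

/-- `f` is a generic sequence of forms of degrees `d i` over the base field `F`: each `f i` is
homogeneous of degree `d i` and the family of all coefficients (at all monomials of degree
`d i`) is algebraically independent over `F`. -/
def IsGenericSeq (F : Type*) {K : Type*} [CommRing F] [CommRing K] [Algebra F K]
    {n r : ℕ} (d : Fin r → ℕ) (f : Fin r → MvPolynomial (Fin n) K) : Prop :=
  (∀ i, (f i).IsHomogeneous (d i)) ∧
    AlgebraicIndependent F
      (fun p : Σ i : Fin r, { μ : Fin n →₀ ℕ // expDeg μ = d i } => (f p.1).coeff p.2.1)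

/-- The projection `K[x_1,…,x_n,z] → K[x_1,…,x_n]` sending `z` (the last variable) to `0` and
fixing the other variables. -/
noncomputable def projMap (K : Type*) [CommRing K] (n : ℕ) :
    MvPolynomial (Fin (n + 1)) K →ₐ[K] MvPolynomial (Fin n) K :=
  aeval (fun i => Fin.lastCases 0 (fun j => X j) i)

/-- Embedding of exponent vectors of `K[x_1,…,x_n]` into those of `K[x_1,…,x_n,z]`
(`z`-exponent `0`). -/
noncomputable def embExp {n : ℕ} (μ : Fin n →₀ ℕ) : Fin (n + 1) →₀ ℕ :=
  Finsupp.embDomain ⟨Fin.castSucc, Fin.castSucc_injective n⟩ μ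

/-- Multiplication by `z^c` on exponent vectors in `K[x_1,…,x_n,z]`. -/
noncomputable def zShift {n : ℕ} (c : ℕ) (μ : Fin (n + 1) →₀ ℕ) : Fin (n + 1) →₀ ℕ :=
  μ + Finsupp.single (Fin.last n) c

/-- `f` (homogeneous of degree `e`) is semi-regular on `R/I`: in each degree `t`, the
multiplication map `(R/I)_t → (R/I)_{t+e}` is injective or surjective. -/
def SemiRegularOn {vars K : Type*} [CommRing K] (I : Ideal (MvPolynomial vars K))
    (f : MvPolynomial vars K) (e : ℕ) : Prop :=
  ∀ t : ℕ,
    (∀ p ∈ homogeneousSubmodule vars K t, f * p ∈ I → p ∈ I) ∨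
    (∀ q ∈ homogeneousSubmodule vars K (t + e),
      ∃ p ∈ homogeneousSubmodule vars K t, q - f * p ∈ I)

/-- The degree-`t` graded piece of `R/I`, as a `K`-submodule of the quotient. -/
noncomputable def quotDegPart {vars K : Type*} [CommRing K] (I : Ideal (MvPolynomial vars K))
    (t : ℕ) : Submodule K (MvPolynomial vars K ⧸ I) :=
  (homogeneousSubmodule vars K t).map (Ideal.Quotient.mkₐ K I).toLinearMap

/-! ### Specialization of spanning families -/

/-- If a family of vectors with polynomial entries spans after specialization at some point, then
it spans after specialization at any algebraically independent point. -/
theorem span_range_aeval_eq_top_of_algebraicIndependent {F K ι J T : Type*} [Field F] [Field K]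
    [Algebra F K] [Finite T] {c : ι → K} (hc : AlgebraicIndependent F c) (p : ι → K)
    (G : J → T → MvPolynomial ι F)
    (h : Submodule.span K (Set.range fun j τ => aeval p (G j τ)) = ⊤) :
    Submodule.span K (Set.range fun j τ => aeval c (G j τ)) = ⊤ := by
  classical
  have := Fintype.ofFinite T
  obtain ⟨κ, a, -, hspan, hli⟩ := exists_linearIndependent' K fun j τ => aeval p (G j τ)
  let b := Module.Basis.mk hli (by rw [hspan, h])
  let ε : T ≃ κ := (Pi.basisFun K T).indexEquiv b
  let M : Matrix T T (MvPolynomial ι F) := Matrix.of fun i τ => G (a (ε i)) τ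
  have hp : IsUnit ((aeval p).mapMatrix M) := by
    rw [← Matrix.linearIndependent_rows_iff_isUnit]
    exact hli.comp ε ε.injective
  have hM : M.det ≠ 0 := by
    intro h0
    have := (Matrix.isUnit_iff_isUnit_det _).1 hp
    rw [← AlgHom.map_det, h0, map_zero] at this
    exact not_isUnit_zero this
  have hcM : IsUnit ((aeval c).mapMatrix M) := by
    rw [Matrix.isUnit_iff_isUnit_det, ← AlgHom.map_det, isUnit_iff_ne_zero]
    exact fun h0 => hM (hc (by rw [h0, map_zero]))
  have hli' := Matrix.linearIndependent_rows_iff_isUnit.2 hcM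
  rw [eq_top_iff, ← hli'.span_eq_top_of_card_eq_finrank' (by simp)]
  apply Submodule.span_mono
  rintro _ ⟨i, rfl⟩
  exact ⟨a (ε i), rfl⟩

/-! ### Generic binary forms -/

/-- Modulo a generic binary form `h` of degree `b`, the monomial `y ^ m * x ^ s` with
`b + D ≤ m + 2 * s + 1` reduces to monomials whose exponent of `x` is either less than `s` or at
least `D`. -/
theorem pow_mul_pow_mem_span_binaryForm {F K P : Type*} [Field F] [Field K] [Algebra F K]
    [CommRing P] [Algebra K P] (x y : P) {b : ℕ} {c : Fin (b + 1) → K}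
    (hc : AlgebraicIndependent F c) {D m s : ℕ} (hb : b + D ≤ m + 2 * s + 1) :
    y ^ m * x ^ s ∈
      (Ideal.span {∑ r : Fin (b + 1), c r • (y ^ (b - r) * x ^ (r : ℕ))}).restrictScalars K ⊔
        Submodule.span K {p | ∃ i j, i + j = m + s ∧ (j < s ∨ D ≤ j) ∧ p = y ^ i * x ^ j} := by
  classical
  set h := ∑ r : Fin (b + 1), c r • (y ^ (b - r) * x ^ (r : ℕ)) with hh
  set S := Submodule.span K {p | ∃ i j, i + j = m + s ∧ (j < s ∨ D ≤ j) ∧ p = y ^ i * x ^ j}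
  set L := (Ideal.span {h}).restrictScalars K ⊔ S
  by_cases hsD : D ≤ s
  · exact Submodule.mem_sup_right (Submodule.subset_span ⟨m, s, rfl, Or.inr hsD, rfl⟩)
  let T := {j : Fin (m + s + 1) // s ≤ j ∧ (j : ℕ) < D}
  let J := {q : ℕ // q + b ≤ m + s}
  let G : J → T → MvPolynomial (Fin (b + 1)) F := fun q j =>
    if hq : q.1 ≤ j.1 ∧ j.1.1 - q.1 < b + 1 then X ⟨j.1.1 - q.1, hq.2⟩ else 0
  have htop : Submodule.span K (Set.range fun q j => aeval c (G q j)) = ⊤ := by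
    let r : Fin (b + 1) := ⟨min s b, by omega⟩
    refine span_range_aeval_eq_top_of_algebraicIndependent hc (Pi.single r 1) G ?_
    rw [eq_top_iff, ← (Pi.basisFun K T).span_eq]
    apply Submodule.span_mono
    rintro _ ⟨⟨⟨j, hj⟩, hj1, hj2⟩, rfl⟩
    simp only at hj1 hj2
    refine ⟨⟨j - min s b, by omega⟩, ?_⟩
    ext ⟨⟨j', hj'⟩, hj1', hj2'⟩
    simp only at hj1' hj2'
    simp only [G, Pi.basisFun_apply, r]
    by_cases hjj : j' = j
    · subst hjj
      rw [Pi.single_eq_same, dif_pos (by omega), aeval_X, Pi.single_apply, if_pos]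
      ext
      dsimp only
      omega
    · rw [Pi.single_eq_of_ne fun h => hjj (congrArg (fun z : T => z.1.1) h)]
      split_ifs
      · rw [aeval_X, Pi.single_eq_of_ne]
        intro h
        have := congrArg Fin.val h
        dsimp only at this
        omega
      · rw [map_zero]
  let Ψ : (T → K) →ₗ[K] P := Fintype.linearCombination K
    fun j : T => y ^ (m + s - j.1) * x ^ (j.1 : ℕ)
  have hΨ : ∀ w, Ψ w ∈ L := by
    have : (⊤ : Submodule K (T → K)) ≤ L.comap Ψ := by
      rw [← htop, Submodule.span_le]
      rintro _ ⟨⟨q, hq⟩, rfl⟩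
      have hmem : y ^ (m + s - b - q) * x ^ q * h ∈ L :=
        Submodule.mem_sup_left (Ideal.mul_mem_left _ _ (Ideal.mem_span_singleton_self h))
      let C : ℕ → K := fun j => if hr : q ≤ j ∧ j - q < b + 1 then c ⟨j - q, hr.2⟩ else 0
      have hexp : y ^ (m + s - b - q) * x ^ q * h =
          ∑ j : Fin (m + s + 1), C j • (y ^ (m + s - j) * x ^ (j : ℕ)) := by
        rw [hh, Finset.mul_sum]
        refine Finset.sum_of_injOn (fun r : Fin (b + 1) => ⟨q + r, by omega⟩) ?_ ?_ ?_ ?_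
        · intro r _ r' _ hrr
          simp only [Fin.mk.injEq] at hrr
          ext
          omega
        · simp
        · intro j _ hj
          have : C j = 0 := by
            refine dif_neg fun hr => hj ⟨⟨j - q, hr.2⟩, by simp, ?_⟩
            ext
            simp only
            omega
          rw [this, zero_smul]
        · intro r _
          have : C (q + r) = c r := by
            have hr : q ≤ q + r ∧ q + r - q < b + 1 := by omega
            simp only [C]
            rw [dif_pos hr]
            congr 1
            ext
            simp
          simp only [this]
          rw [mul_smul_comm]
          congr 1
          have : m + s - (q + r) = (m + s - b - q) + (b - r) := by omega
          rw [this]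
          ring
      rw [hexp, ← Finset.sum_filter_add_sum_filter_not Finset.univ
        (fun j : Fin (m + s + 1) => s ≤ j ∧ (j : ℕ) < D)] at hmem
      have hrest : ∑ j ∈ Finset.univ.filter
          (fun j : Fin (m + s + 1) => ¬ (s ≤ (j : ℕ) ∧ (j : ℕ) < D)),
          C j • (y ^ (m + s - j) * x ^ (j : ℕ)) ∈ L := by
        refine Submodule.sum_mem _ fun j hj => Submodule.smul_mem _ _ (Submodule.mem_sup_right
          (Submodule.subset_span ⟨m + s - j, j, by omega, ?_, rfl⟩))
        simp only [Finset.mem_filter] at hj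
        omega
      have := (Submodule.add_mem_iff_left _ hrest).1 hmem
      have hΨq : Ψ (fun τ => aeval c (G ⟨q, hq⟩ τ)) =
          ∑ j ∈ Finset.univ.filter (fun j : Fin (m + s + 1) => s ≤ (j : ℕ) ∧ (j : ℕ) < D),
            C j • (y ^ (m + s - j) * x ^ (j : ℕ)) := by
        rw [← Finset.sum_subtype_eq_sum_filter, Finset.subtype_univ]
        refine (Fintype.linearCombination_apply K _ _).trans (Finset.sum_congr rfl fun j _ => ?_)
        congr 1
        simp only [G, C]
        split_ifs <;> simp
      change Ψ (fun τ => aeval c (G ⟨q, hq⟩ τ)) ∈ L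
      rwa [hΨq]
    exact fun w => this Submodule.mem_top
  have := hΨ (Pi.single ⟨⟨s, by omega⟩, by simp only; omega⟩ 1)
  simpa [Ψ] using this

/-! ### A special sequence of forms -/

/-- The span of the monomials of degree `t` in `x 0, …, x k`. -/
def formSpan (K : Type*) {P : Type*} [Field K] [CommRing P] [Algebra K P] (x : ℕ → P) :
    ℕ → ℕ → Submodule K P
  | 0, t => Submodule.span K {x 0 ^ t}
  | k + 1, t => Submodule.span K
      {p | ∃ s u, u + s = t ∧ ∃ a ∈ formSpan K x k u, p = a * x (k + 1) ^ s}

section formSpan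

variable {K P : Type*} [Field K] [CommRing P] [Algebra K P] (x : ℕ → P)

theorem mul_pow_mem_formSpan_succ {k u : ℕ} {a : P} (ha : a ∈ formSpan K x k u) (s : ℕ) :
    a * x (k + 1) ^ s ∈ formSpan K x (k + 1) (u + s) :=
  Submodule.subset_span ⟨s, u, rfl, a, ha, rfl⟩

theorem mul_pow_mem_formSpan {k u : ℕ} {a : P} (ha : a ∈ formSpan K x k u) (i : ℕ) :
    a * x k ^ i ∈ formSpan K x k (u + i) := by
  have key : formSpan K x k u ≤
      (formSpan K x k (u + i)).comap (LinearMap.mulRight K (x k ^ i)) := by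
    cases k with
    | zero =>
      refine Submodule.span_le.2 ?_
      rintro _ rfl
      exact Submodule.subset_span (by simp [pow_add])
    | succ k =>
      refine Submodule.span_le.2 ?_
      rintro _ ⟨s, v, rfl, a, ha, rfl⟩
      have := mul_pow_mem_formSpan_succ x ha (s + i)
      rw [pow_add, ← mul_assoc, ← add_assoc] at this
      exact this
  exact key ha

theorem prod_pow_mem_formSpan (k : ℕ) (μ : ℕ → ℕ) :
    ∏ i ∈ Finset.range (k + 1), x i ^ μ i ∈
      formSpan K x k (∑ i ∈ Finset.range (k + 1), μ i) := by
  induction k with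
  | zero => exact Submodule.subset_span (by simp)
  | succ k ih =>
    rw [Finset.prod_range_succ, Finset.sum_range_succ]
    exact mul_pow_mem_formSpan_succ x ih _

theorem formSpan_le (f : ℕ → P) (d : ℕ → ℕ) (n : ℕ) (hf : f 0 = x 0 ^ d 0)
    (hbin : ∀ k < n, ∀ D m s, d (k + 1) + D ≤ m + 2 * s + 1 →
      x k ^ m * x (k + 1) ^ s ∈ (Ideal.span {f (k + 1)}).restrictScalars K ⊔
        Submodule.span K
          {p | ∃ i j, i + j = m + s ∧ (j < s ∨ D ≤ j) ∧ p = x k ^ i * x (k + 1) ^ j})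
    (k : ℕ) (hk : k ≤ n) (D t : ℕ)
    (ht : ∑ i ∈ Finset.range (k + 1), d i + D ≤ 2 * t + (k + 1)) :
    formSpan K x k t ≤ (Ideal.span (f '' Set.Iic k)).restrictScalars K ⊔
      Submodule.span K {p | ∃ u, u + D = t ∧ ∃ a ∈ formSpan K x k u, p = a * x k ^ D} := by
  induction k generalizing D t with
  | zero =>
    refine Submodule.span_le.2 ?_
    rintro _ rfl
    simp only [zero_add, Finset.sum_range_one] at ht
    by_cases hD : D ≤ t
    · refine Submodule.mem_sup_right (Submodule.subset_span
        ⟨t - D, by omega, x 0 ^ (t - D), Submodule.subset_span rfl, ?_⟩)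
      rw [← pow_add, Nat.sub_add_cancel hD]
    · refine Submodule.mem_sup_left ?_
      have : x 0 ^ t = x 0 ^ (t - d 0) * f 0 := by
        rw [hf, ← pow_add, Nat.sub_add_cancel (by omega)]
      rw [this]
      exact Ideal.mul_mem_left _ _ (Ideal.subset_span (Set.mem_image_of_mem f (by simp)))
  | succ k ih =>
    rw [Finset.sum_range_succ] at ht
    set I := (Ideal.span (f '' Set.Iic (k + 1))).restrictScalars K
    set Y := Submodule.span K
      {p | ∃ u, u + D = t ∧ ∃ a ∈ formSpan K x (k + 1) u, p = a * x (k + 1) ^ D}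
    have main : ∀ s u, u + s = t → ∀ a ∈ formSpan K x k u, a * x (k + 1) ^ s ∈ I ⊔ Y := by
      intro s
      induction s using Nat.strong_induction_on with
      | _ s ihs =>
      intro u hu a ha
      set m := d (k + 1) + D - 1 - 2 * s with hm
      have ha' : a ∈ (Ideal.span (f '' Set.Iic k)).restrictScalars K ⊔
          Submodule.span K {p | ∃ v, v + m = u ∧ ∃ a ∈ formSpan K x k v, p = a * x k ^ m} := by
        by_cases hm0 : m = 0
        · refine Submodule.mem_sup_right (Submodule.subset_span ⟨u, by omega, a, ha, ?_⟩)
          rw [hm0, pow_zero, mul_one]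
        · exact ih (by omega) m u (by omega) ha
      have hle : (Ideal.span (f '' Set.Iic k)).restrictScalars K ⊔
          Submodule.span K {p | ∃ v, v + m = u ∧ ∃ a ∈ formSpan K x k v, p = a * x k ^ m} ≤
          (I ⊔ Y).comap (LinearMap.mulRight K (x (k + 1) ^ s)) := by
        refine sup_le ?_ (Submodule.span_le.2 ?_)
        · intro p hp
          refine Submodule.mem_sup_left (Ideal.mul_mem_right _ _ ?_)
          exact Ideal.span_mono (Set.image_mono (Set.Iic_subset_Iic.2 k.le_succ)) hp
        · rintro _ ⟨v, hv, a', ha', rfl⟩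
          have hb := hbin k (by omega) D m s (by omega)
          have hle' : (Ideal.span {f (k + 1)}).restrictScalars K ⊔
              Submodule.span K
                {p | ∃ i j, i + j = m + s ∧ (j < s ∨ D ≤ j) ∧ p = x k ^ i * x (k + 1) ^ j} ≤
              (I ⊔ Y).comap (LinearMap.mulLeft K a') := by
            refine sup_le ?_ (Submodule.span_le.2 ?_)
            · intro p hp
              refine Submodule.mem_sup_left (Ideal.mul_mem_left _ _ (Ideal.span_mono ?_ hp))
              exact Set.singleton_subset_iff.2 (Set.mem_image_of_mem f Set.self_mem_Iic)
            · rintro _ ⟨i, j, hij, hj, rfl⟩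
              have hai := mul_pow_mem_formSpan x ha' i
              change a' * (x k ^ i * x (k + 1) ^ j) ∈ I ⊔ Y
              rw [← mul_assoc]
              rcases hj with hj | hj
              · exact ihs j hj (v + i) (by omega) _ hai
              · refine Submodule.mem_sup_right (Submodule.subset_span
                  ⟨v + i + (j - D), by omega, _, mul_pow_mem_formSpan_succ x hai (j - D), ?_⟩)
                rw [mul_assoc _ _ (x (k + 1) ^ D), ← pow_add, Nat.sub_add_cancel hj]
          have := hle' hb
          simpa [mul_assoc] using this
      exact hle ha'
    refine Submodule.span_le.2 ?_
    rintro _ ⟨s, u, hu, a, ha, rfl⟩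
    exact main s u hu a ha

end formSpan

/-! ### Transfer to generic sequences -/

theorem expDeg_eq_degree {n : ℕ} (μ : Fin n →₀ ℕ) : expDeg μ = μ.degree := rfl

theorem expDeg_eq_sum {n : ℕ} (μ : Fin n →₀ ℕ) : expDeg μ = ∑ i, μ i :=
  Finsupp.sum_fintype _ _ fun _ => rfl

theorem embExp_castSucc {n : ℕ} (μ : Fin n →₀ ℕ) (i : Fin n) : embExp μ i.castSucc = μ i :=
  Finsupp.embDomain_apply_self ⟨Fin.castSucc, Fin.castSucc_injective n⟩ μ i

theorem embExp_last {n : ℕ} (μ : Fin n →₀ ℕ) : embExp μ (Fin.last n) = 0 :=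
  Finsupp.embDomain_of_notMem_range _ _ _ (by simp)

theorem embExp_add {n : ℕ} (μ ν : Fin n →₀ ℕ) : embExp (μ + ν) = embExp μ + embExp ν :=
  Finsupp.embDomain_add _ _ _

theorem embExp_le_embExp {n : ℕ} {μ ν : Fin n →₀ ℕ} : embExp μ ≤ embExp ν ↔ μ ≤ ν := by
  refine ⟨fun h i => ?_, fun h => ?_⟩
  · simpa only [embExp_castSucc] using h i.castSucc
  · obtain ⟨ρ, rfl⟩ := exists_add_of_le h
    rw [embExp_add]
    exact le_self_add

theorem expDeg_embExp {n : ℕ} (μ : Fin n →₀ ℕ) : expDeg (embExp μ) = expDeg μ := by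
  simp [expDeg_eq_sum, Fin.sum_univ_castSucc, embExp_castSucc, embExp_last]

theorem exists_embExp_eq {n : ℕ} {μ : Fin (n + 1) →₀ ℕ} (h : μ (Fin.last n) = 0) :
    ∃ ν, embExp ν = μ := by
  refine ⟨Finsupp.equivFunOnFinite.symm fun i => μ i.castSucc, ?_⟩
  ext i
  induction i using Fin.lastCases with
  | last => rw [embExp_last, h]
  | cast i => rw [embExp_castSucc]; rfl

theorem expDeg_zShift {n : ℕ} (c : ℕ) (μ : Fin (n + 1) →₀ ℕ) :
    expDeg (zShift c μ) = expDeg μ + c := by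
  simp [expDeg_eq_degree, zShift]

instance finite_expDeg_eq (n t : ℕ) : Finite {μ : Fin n →₀ ℕ // expDeg μ = t} := by
  refine Set.Finite.subset (Set.finite_Iic (Finsupp.equivFunOnFinite.symm fun _ => t)) ?_
  rintro μ rfl i
  exact Finsupp.le_degree i μ

/-- If some forms of degrees `e i` in the variables other than the last one generate all monomials
of degree `t`, then every such monomial is a leading monomial in the ideal of a generic sequence of
forms of degrees `e i`. -/
theorem monomial_embExp_mem_initialIdeal {F K : Type*} [Field F] [Field K] [Algebra F K]
    {n r : ℕ} {e : Fin r → ℕ} {f : Fin r → MvPolynomial (Fin (n + 1)) K}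
    (hf : IsGenericSeq F e f) {P : Fin r → MvPolynomial (Fin n) K}
    (hP : ∀ i, (P i).IsHomogeneous (e i)) {t : ℕ}
    (hspan : ∀ μ : Fin n →₀ ℕ, expDeg μ = t → monomial μ (1 : K) ∈ Ideal.span (Set.range P))
    (μ : Fin n →₀ ℕ) (hμ : expDeg μ = t) :
    monomial (embExp μ) (1 : K) ∈ initialIdeal (Ideal.span (Set.range f)) := by
  classical
  let ι := Σ i : Fin r, {μ : Fin n →₀ ℕ // expDeg μ = e i}
  let T := {μ : Fin n →₀ ℕ // expDeg μ = t}
  let J := Σ i : Fin r, {ν : Fin n →₀ ℕ // expDeg ν + e i = t}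
  let c : ι → K := fun p => (f p.1).coeff (embExp p.2.1)
  have hc : AlgebraicIndependent F c := by
    refine hf.2.comp (fun p : ι => ⟨p.1, embExp p.2.1, (expDeg_embExp _).trans p.2.2⟩) ?_
    rintro ⟨i, μ, hμ⟩ ⟨i', μ', hμ'⟩ h
    simp only [Sigma.mk.injEq] at h
    obtain ⟨rfl, h⟩ := h
    simp only [heq_eq_eq, Subtype.mk.injEq] at h
    have : μ = μ' := le_antisymm (embExp_le_embExp.1 h.le) (embExp_le_embExp.1 h.ge)
    subst this
    rfl
  let p : ι → K := fun q => (P q.1).coeff q.2.1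
  have hdeg : ∀ (j : J) (τ : T), j.2.1 ≤ τ.1 → expDeg (τ.1 - j.2.1) = e j.1 := by
    rintro ⟨i, ν, hν⟩ ⟨τ, hτ⟩ h
    obtain ⟨ρ, rfl⟩ := exists_add_of_le h
    simp only [expDeg_eq_degree, map_add, add_tsub_cancel_left] at hν hτ ⊢
    omega
  let G : J → T → MvPolynomial ι F := fun j τ =>
    if h : j.2.1 ≤ τ.1 then X ⟨j.1, τ.1 - j.2.1, hdeg j τ h⟩ else 0
  have hGp : ∀ j τ, aeval p (G j τ) = coeff τ.1 (monomial j.2.1 1 * P j.1) := by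
    intro j τ
    rw [coeff_monomial_mul']
    simp only [G]
    split_ifs <;> simp [p]
  have hGc : ∀ j τ, aeval c (G j τ) =
      coeff (embExp τ.1) (monomial (embExp j.2.1) 1 * f j.1) := by
    intro j τ
    simp only [G]
    split_ifs with h
    · have hadd : embExp τ.1 = embExp j.2.1 + embExp (τ.1 - j.2.1) := by
        rw [← embExp_add, add_tsub_cancel_of_le h]
      rw [hadd, coeff_monomial_mul, one_mul, aeval_X]
    · rw [coeff_monomial_mul', if_neg (by rwa [embExp_le_embExp]), map_zero]
  have htopP : Submodule.span K (Set.range fun j τ => aeval p (G j τ)) = ⊤ := by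
    let Φ : MvPolynomial (Fin n) K →ₗ[K] (T → K) := LinearMap.pi fun τ => lcoeff K τ.1
    have hideal : ∀ q ∈ Ideal.span (Set.range P),
        Φ q ∈ Submodule.span K (Set.range fun j τ => aeval p (G j τ)) := by
      intro q hq
      suffices ∀ a, Φ (a * q) ∈ Submodule.span K (Set.range fun j τ => aeval p (G j τ)) by
        simpa using this 1
      induction hq using Submodule.span_induction with
      | mem q hq =>
        obtain ⟨i, rfl⟩ := hq
        intro a
        induction a using MvPolynomial.induction_on' with
        | add a b ha hb => rw [add_mul, map_add]; exact add_mem ha hb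
        | monomial ν k =>
          have : monomial ν k * P i = k • (monomial ν 1 * P i) := by
            rw [← smul_mul_assoc, smul_monomial, smul_eq_mul, mul_one]
          rw [this, map_smul]
          refine Submodule.smul_mem _ _ ?_
          by_cases hν : expDeg ν + e i = t
          · exact Submodule.subset_span ⟨⟨i, ν, hν⟩, funext fun τ => hGp _ _⟩
          · convert Submodule.zero_mem _
            ext τ
            have := ((isHomogeneous_monomial (1 : K) (d := ν) rfl).mul (hP i)).coeff_eq_zero
              (d := τ.1) (by
                have := τ.2
                rw [expDeg_eq_degree] at this hν
                omega)
            exact this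
      | zero => simp
      | add a b _ _ ha hb =>
        intro k
        rw [mul_add, map_add]
        exact add_mem (ha k) (hb k)
      | smul a b _ hb =>
        intro k
        rw [smul_eq_mul, ← mul_assoc]
        exact hb _
    rw [eq_top_iff, ← (Pi.basisFun K T).span_eq, Submodule.span_le]
    rintro _ ⟨τ, rfl⟩
    have hτ : Pi.basisFun K T τ = Φ (monomial τ.1 1) := by
      ext τ'
      simp only [Pi.basisFun_apply, Pi.single_apply, Φ, LinearMap.pi_apply, lcoeff_apply,
        coeff_monomial, eq_comm, ← Subtype.ext_iff]
    rw [hτ]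
    exact hideal _ (hspan τ.1 τ.2)
  have htop := span_range_aeval_eq_top_of_algebraicIndependent hc p G htopP
  let Φ : MvPolynomial (Fin (n + 1)) K →ₗ[K] (T → K) :=
    LinearMap.pi fun τ => lcoeff K (embExp τ.1)
  let v : J → MvPolynomial (Fin (n + 1)) K := fun j => monomial (embExp j.2.1) 1 * f j.1
  obtain ⟨q, hq, hqΦ⟩ : ∃ q ∈ Submodule.span K (Set.range v), Φ q = Pi.single ⟨μ, hμ⟩ 1 := by
    rw [← Submodule.mem_map, Submodule.map_span, ← Set.range_comp]
    convert Submodule.mem_top (R := K) (x := (Pi.single ⟨μ, hμ⟩ 1 : T → K))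
    rw [← htop]
    congr! 3
    ext j
    simp [hGc, Φ, v]
  have hqI : q ∈ Ideal.span (Set.range f) := by
    have : Submodule.span K (Set.range v) ≤
        (Ideal.span (Set.range f)).restrictScalars K := by
      rw [Submodule.span_le]
      rintro _ ⟨j, rfl⟩
      exact Ideal.mul_mem_left _ _ (Ideal.subset_span ⟨j.1, rfl⟩)
    exact this hq
  have hqt : q.IsHomogeneous t := by
    have : Submodule.span K (Set.range v) ≤ homogeneousSubmodule (Fin (n + 1)) K t := by
      rw [Submodule.span_le]
      rintro _ ⟨⟨i, ν, hν⟩, rfl⟩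
      have h := (isHomogeneous_monomial (1 : K) (d := embExp ν) rfl).mul (hf.1 i)
      rw [← expDeg_eq_degree, expDeg_embExp, hν] at h
      exact h
    exact this hq
  have hcoeff : ∀ τ : T, coeff (embExp τ.1) q = (Pi.single ⟨μ, hμ⟩ 1 : T → K) τ :=
    fun τ => congrFun hqΦ τ
  have hqμ : coeff (embExp μ) q = 1 := by simpa using hcoeff ⟨μ, hμ⟩
  refine Ideal.subset_span ⟨q, hqI, ?_, embExp μ, ⟨?_, ?_⟩, rfl⟩
  · rintro rfl
    simp at hqμ
  · rw [mem_support_iff, hqμ]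
    exact one_ne_zero
  · intro ν hν hne
    rw [mem_support_iff] at hν
    have hνt : expDeg ν = t := by
      by_contra h
      exact hν (hqt.coeff_eq_zero h)
    refine Or.inr ⟨by rw [hνt, expDeg_embExp, hμ], Fin.last n, ?_,
      fun j hj => absurd (Fin.le_last j) (not_le.2 hj)⟩
    rw [embExp_last]
    by_contra h0
    obtain ⟨τ, rfl⟩ := exists_embExp_eq (μ := ν) (by omega)
    rw [expDeg_embExp] at hνt
    rw [hcoeff ⟨τ, hνt⟩, Pi.single_apply] at hν
    simp only [ne_eq, ite_eq_right_iff, one_ne_zero, imp_false, not_not] at hν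
    exact hne (congrArg (fun τ : T => embExp τ.1) hν)

/-- There are forms of the given degrees such that every monomial of sufficiently high degree lies
in the ideal that they generate together with a power of the last variable. -/
theorem exists_isHomogeneous_monomial_mem_span {F K : Type*} [Field F] [Field K] [Algebra F K]
    {n : ℕ} {d : Fin (n + 1) → ℕ} (D : ℕ) {c : (k : Fin n) → Fin (d k.succ + 1) → K}
    (hc : ∀ k, AlgebraicIndependent F (c k)) :
    ∃ P : Fin (n + 1) → MvPolynomial (Fin (n + 1)) K, (∀ i, (P i).IsHomogeneous (d i)) ∧
      ∀ μ : Fin (n + 1) →₀ ℕ, ∑ i, d i + D ≤ 2 * expDeg μ + (n + 1) →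
        monomial μ (1 : K) ∈ Ideal.span (Set.range P) ⊔ Ideal.span {X (Fin.last n) ^ D} := by
  let P : Fin (n + 1) → MvPolynomial (Fin (n + 1)) K := fun i => Fin.cases (X 0 ^ d 0)
    (fun k => ∑ r, c k r • (X k.castSucc ^ (d k.succ - r) * X k.succ ^ (r : ℕ))) i
  refine ⟨P, fun i => ?_, fun μ hμ => ?_⟩
  · cases i using Fin.cases with
    | zero => exact isHomogeneous_X_pow 0 (d 0)
    | succ k =>
      refine (homogeneousSubmodule _ K (d k.succ)).sum_mem fun r _ =>
        Submodule.smul_mem _ _ ?_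
      have := (isHomogeneous_X_pow (R := K) k.castSucc (d k.succ - r)).mul
        (isHomogeneous_X_pow k.succ (r : ℕ))
      rwa [Nat.sub_add_cancel (Nat.le_of_lt_succ r.2)] at this
  · let x : ℕ → MvPolynomial (Fin (n + 1)) K := fun k => X (Fin.ofNat (n + 1) k)
    have hx : ∀ i : Fin (n + 1), x i = X i := fun i => by simp [x]
    have hle := formSpan_le (K := K) x (fun k => P (Fin.ofNat (n + 1) k))
      (fun k => d (Fin.ofNat (n + 1) k)) n rfl ?_ n le_rfl D (expDeg μ) ?_
    · have hmem := hle (x := monomial μ 1) ?_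
      · rw [← Submodule.restrictScalars_mem K]
        refine (sup_le ?_ (Submodule.span_le.2 ?_) : _ ≤ (Ideal.span (Set.range P) ⊔
          Ideal.span {X (Fin.last n) ^ D}).restrictScalars K) hmem
        · intro p hp
          refine Ideal.mem_sup_left (Ideal.span_mono ?_ hp)
          rintro _ ⟨k, -, rfl⟩
          exact ⟨_, rfl⟩
        · rintro _ ⟨u, -, a, -, rfl⟩
          have : x n = X (Fin.last n) := hx (Fin.last n)
          rw [this]
          exact Ideal.mem_sup_right (Ideal.mul_mem_left _ _ (Ideal.mem_span_singleton_self _))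
      · have := prod_pow_mem_formSpan (K := K) x n fun k => μ (Fin.ofNat (n + 1) k)
        rw [Finset.prod_range, Finset.sum_range] at this
        simpa [hx, ← expDeg_eq_sum, monomial_eq, Finsupp.prod_fintype] using this
    · intro k hk D m s h
      obtain ⟨k, rfl⟩ : ∃ i : Fin n, (i : ℕ) = k := ⟨⟨k, hk⟩, rfl⟩
      have h0 : Fin.ofNat (n + 1) k = k.castSucc := by ext; simp
      have h1 : Fin.ofNat (n + 1) (k + 1) = k.succ := by ext; simp
      simp only [h1] at h
      simp only [x, h0, h1]
      exact pow_mul_pow_mem_span_binaryForm _ _ (hc k) h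
    · rw [Finset.sum_range]
      simpa using hμ

/-- The monomials of high degree not involving the last variable are leading monomials in a generic
ideal. -/
theorem monomial_mem_initialIdeal_of_isGenericSeq {F K : Type*} [Field F] [Field K] [Algebra F K]
    {n : ℕ} {d : Fin (n + 1) → ℕ} {D : ℕ} {f : Fin (n + 1) → MvPolynomial (Fin (n + 2)) K}
    {g : MvPolynomial (Fin (n + 2)) K} (hfg : IsGenericSeq F (Fin.snoc d D) (Fin.snoc f g))
    {μ : Fin (n + 2) →₀ ℕ} (hμ : μ (Fin.last (n + 1)) = 0)
    (hdeg : ∑ i, d i + D ≤ 2 * expDeg μ + (n + 1)) :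
    monomial μ (1 : K) ∈ initialIdeal (Ideal.span (Set.range (Fin.snoc f g))) := by
  obtain ⟨μ, rfl⟩ := exists_embExp_eq hμ
  rw [expDeg_embExp] at hdeg
  let E : (k : Fin n) → Fin (d k.succ + 1) → (Fin (n + 1) →₀ ℕ) := fun k r =>
    Finsupp.single k.castSucc (d k.succ - r) + Finsupp.single k.succ (r : ℕ)
  have hE : ∀ k r, expDeg (embExp (E k r)) = d k.succ := fun k r => by
    rw [expDeg_embExp, expDeg_eq_degree, map_add, Finsupp.degree_single, Finsupp.degree_single]
    omega
  have hc : ∀ k, AlgebraicIndependent F fun r => coeff (embExp (E k r)) (f k.succ) := by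
    intro k
    have hsnoc : (Fin.snoc f g : Fin (n + 2) → MvPolynomial (Fin (n + 2)) K) k.succ.castSucc =
      f k.succ := Fin.snoc_castSucc ..
    rw [← hsnoc]
    refine hfg.2.comp (fun r => ⟨k.succ.castSucc, embExp (E k r),
      (hE k r).trans (Fin.snoc_castSucc (α := fun _ => ℕ) D d k.succ).symm⟩) fun r r' h => ?_
    simp only [Sigma.mk.injEq, heq_eq_eq, true_and, Subtype.mk.injEq] at h
    have := DFunLike.congr_fun h k.succ.castSucc
    rw [embExp_castSucc, embExp_castSucc] at this
    ext
    simpa only [E, Finsupp.add_apply, Finsupp.single_eq_same,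
      Finsupp.single_eq_of_ne Fin.castSucc_lt_succ.ne', zero_add] using this
  obtain ⟨P, hP, hspan⟩ := exists_isHomogeneous_monomial_mem_span D hc
  refine monomial_embExp_mem_initialIdeal hfg (P := Fin.snoc P (X (Fin.last n) ^ D)) ?_
    (fun ν hν => ?_) μ rfl
  · intro i
    cases i using Fin.lastCases with
    | last => simpa using isHomogeneous_X_pow (R := K) (Fin.last n) D
    | cast i => simpa using hP i
  · rw [Fin.range_snoc, Ideal.span_insert, sup_comm]
    exact hspan ν (hν ▸ hdeg)

/-- when `d < δ`, the generators of `in(I,g)` from the tail families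
(`z^{2k}·B_{d+i*−k}`, `z^{δ−d+2j}·B_{d−j}` in the even case; `B_{d+i*+1}`,
`z^{2k−1}·B_{d+i*+1−k}`, `z^{δ−d+2j}·B_{d−j}` in the odd case) satisfy property `P`. -/
theorem stmt9 {F K : Type*} [Field F] [Field K] [Algebra F K] [Infinite K]
    {n : ℕ} (hn : 0 < n) (d : Fin n → ℕ) (hd : ∀ i, 1 ≤ d i) (hmono : Monotone d)
    (D : ℕ) (hdD : ∀ i, d i ≤ D)
    (f : Fin n → MvPolynomial (Fin (n + 1)) K) (g : MvPolynomial (Fin (n + 1)) K)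
    (hfg : IsGenericSeq F (Fin.snoc d D) (Fin.snoc f g))
    (I Ig : Ideal (MvPolynomial (Fin (n + 1)) K))
    (hI : I = Ideal.span (Set.range f)) (hIg : Ig = Ideal.span (Set.range (Fin.snoc f g)))
    (J : Ideal (MvPolynomial (Fin n) K)) (hJ : J = I.map (projMap K n))
    (δ istar : ℕ) (hδ : δ = (∑ j, d j) - n) (hDδ : D < δ) (histar : istar = (δ - D) / 2) :
    (Even (δ - D) →
      ∀ μ ∈ (⋃ k ∈ Finset.Icc 1 istar,
              zShift (2 * k) '' (embExp '' stdMon J (D + istar - k))) ∪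
            (⋃ j ∈ Finset.Icc 1 D,
              zShift (δ - D + 2 * j) '' (embExp '' stdMon J (D - j))),
        monomial μ (1 : K) ∈ initialIdeal Ig → SatisfiesP (initialIdeal Ig) μ) ∧
    (Odd (δ - D) →
      ∀ μ ∈ embExp '' stdMon J (D + istar + 1) ∪
            (⋃ k ∈ Finset.Icc 1 (istar + 1),
              zShift (2 * k - 1) '' (embExp '' stdMon J (D + istar + 1 - k))) ∪
            (⋃ j ∈ Finset.Icc 1 D,
              zShift (δ - D + 2 * j) '' (embExp '' stdMon J (D - j))),
        monomial μ (1 : K) ∈ initialIdeal Ig → SatisfiesP (initialIdeal Ig) μ) := by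
  have key : ∀ μ : Fin (n + 1) →₀ ℕ, δ + D ≤ 2 * expDeg μ → SatisfiesP (initialIdeal Ig) μ := by
    intro μ hμ m _ _ ν hν hν0
    obtain ⟨n, rfl⟩ : ∃ m, n = m + 1 := ⟨n - 1, by omega⟩
    rw [hIg]
    refine monomial_mem_initialIdeal_of_isGenericSeq hfg (hν0 _ (Fin.le_last m)) ?_
    rw [hν]
    omega
  constructor
  · rintro ⟨a, ha⟩ μ hμ -
    apply key
    simp only [Set.mem_union, Set.mem_iUnion, Finset.mem_Icc, Set.mem_image, exists_prop] at hμ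
    rcases hμ with ⟨k, hk, _, ⟨μ, hμ, rfl⟩, rfl⟩ | ⟨k, hk, _, ⟨μ, hμ, rfl⟩, rfl⟩ <;>
    · have := hμ.1
      rw [expDeg_zShift, expDeg_embExp]
      omega
  · rintro ⟨a, ha⟩ μ hμ -
    apply key
    simp only [Set.mem_union, Set.mem_iUnion, Finset.mem_Icc, Set.mem_image, exists_prop] at hμ
    rcases hμ with (⟨μ, hμ, rfl⟩ | ⟨k, hk, _, ⟨μ, hμ, rfl⟩, rfl⟩) | ⟨k, hk, _, ⟨μ, hμ, rfl⟩, rfl⟩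
    · have := hμ.1
      rw [expDeg_embExp]
      omega
    all_goals
      have := hμ.1
      rw [expDeg_zShift, expDeg_embExp]
      omega
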